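/- Let G be a finite group, ψ an automorphism of G, and P = {x ∈ G : x is in the orbit of e under the group generated by the maps s_a(y) = a·ψ(a⁻¹y)}. Then P is a normal subgroup of G. -/

import Mathlib

/-- The orbit `P` of the identity under the inner automorphism group of the generalized
Alexander quandle `Q(G, ψ)` (point symmetries `s_a(y) = a * ψ(a⁻¹ y)`). -/
def orbitOfIdentity {G : Type*} [Group G] (ψ : G ≃* G) : Set G :=
  {x | ∃ l : List G, x = l.foldr (fun a y => a * ψ (a⁻¹ * y)) 1}

lemma orbit_map {G : Type*} [Group G] (ψ φ : G ≃* G) (h : ∀ x, φ (ψ x) = ψ (φ x)) (l : List G) :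
    φ (l.foldr (fun a y => a * ψ (a⁻¹ * y)) 1)
      = (l.map φ).foldr (fun a y => a * ψ (a⁻¹ * y)) 1 := by
  induction l with
  | nil => simp
  | cons a l ih =>
    simp only [List.foldr_cons, List.map_cons, ← ih]
    simp [h]

/-- `P` is a normal subgroup of `G`. -/
theorem orbitOfIdentity_normal_subgroup {G : Type*} [Group G] [Finite G] (ψ : G ≃* G) :
    ∃ H : Subgroup G, H.Normal ∧ (H : Set G) = orbitOfIdentity ψ := by
  set S : Set G := Set.range (fun a => a * (ψ a)⁻¹) with hS
  have hd : ∀ a, a * (ψ a)⁻¹ ∈ Subgroup.closure S := fun a =>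
    Subgroup.subset_closure ⟨a, rfl⟩
  refine ⟨Subgroup.closure S, ⟨fun n hn g => ?_⟩, ?_⟩
  · induction hn using Subgroup.closure_induction with
    | mem x hx =>
      obtain ⟨a, rfl⟩ := hx
      have := mul_mem (hd (g * a)) (inv_mem (hd g))
      convert this using 1
      simp [mul_assoc]
    | one => simp
    | mul x y _ _ hx hy =>
      convert mul_mem hx hy using 1
      group
    | inv x _ hx =>
      convert inv_mem hx using 1
      group
  · have hψ : ∀ x ∈ Subgroup.closure S, ψ x ∈ Subgroup.closure S := by
      intro x hx
      induction hx using Subgroup.closure_induction with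
      | mem x hx =>
        obtain ⟨a, rfl⟩ := hx
        simpa using hd (ψ a)
      | one => simp
      | mul x y _ _ hx hy => simpa using mul_mem hx hy
      | inv x _ hx => simpa using hx
    ext x
    constructor
    · intro hx
      have hx' : x ∈ Submonoid.closure S := by
        rw [← Subgroup.closure_toSubmonoid_of_finite]
        exact hx
      clear hx
      induction hx' using Submonoid.closure_induction_left with
      | one => exact ⟨[], rfl⟩
      | mul_left x hx y _ hy =>
        obtain ⟨a, rfl⟩ := hx
        obtain ⟨l, rfl⟩ := hy
        refine ⟨a :: l.map ψ.symm, ?_⟩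
        rw [List.foldr_cons, ← orbit_map ψ ψ.symm (by simp)]
        simp [mul_assoc]
    · rintro ⟨l, rfl⟩
      induction l with
      | nil => exact one_mem (Subgroup.closure S)
      | cons a l ih =>
        have := mul_mem (hd a) (hψ _ ih)
        simpa [mul_assoc] using this
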